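/- arXiv:1811.11362 — 2 statements merged into one kernel-verified Lean document; each statement's English description precedes it below -/
import Mathlib

section
/- Let k ≥ 2 be an integer and set m = F_{k+1}/F_k, where F_n is the n-th Fibonacci number. Then (-1)^{j+1}·(F_j·m - F_{j+1}) > 0 for every j with 1 ≤ j ≤ k - 1, and F_k·m - F_{k+1} = 0. (A rectangle with side ratio F_{k+1}/F_k can be subdivided into exactly k subrectangles by the square-removal process, and the process stops at step k; such rectangles are golden 'with degree k'.) -/
/-- **d'Ocagne's identity** for Fibonacci numbers. -/
theorem Nat.cast_fib_mul_fib_sub_fib_mul_fib {R : Type*} [CommRing R] (j d : ℕ) :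
    (Nat.fib j : R) * Nat.fib (j + d + 1) - Nat.fib (j + 1) * Nat.fib (j + d) =
      (-1) ^ (j + 1) * Nat.fib d := by
  induction j with
  | zero => simp
  | succ j ih =>
    have h : (Nat.fib (j + 1 + d + 1) : R) = Nat.fib (j + d) + Nat.fib (j + d + 1) := by
      rw [show j + 1 + d + 1 = j + d + 2 by ring, Nat.fib_add_two, Nat.cast_add]
    rw [h, show j + 1 + d = j + d + 1 by ring, Nat.fib_add_two, pow_succ]
    push_cast
    linear_combination -ih

theorem fibonacci_ratio_rectangle_degree_k (k : ℕ) (hk : 2 ≤ k) (m : ℝ)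
    (hm : m = (Nat.fib (k + 1) : ℝ) / Nat.fib k) :
    (∀ j : ℕ, 1 ≤ j → j ≤ k - 1 →
      0 < (-1) ^ (j + 1) * ((Nat.fib j : ℝ) * m - Nat.fib (j + 1))) ∧
    (Nat.fib k : ℝ) * m - Nat.fib (k + 1) = 0 := by
  have hpos : (0 : ℝ) < Nat.fib k := by exact_mod_cast Nat.fib_pos.2 (by omega)
  have hmul : (Nat.fib k : ℝ) * m = Nat.fib (k + 1) := by
    rw [hm, mul_div_cancel₀ _ hpos.ne']
  refine ⟨fun j _ hj => ?_, sub_eq_zero.2 hmul⟩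
  obtain ⟨d, rfl⟩ := Nat.exists_eq_add_of_le (show j ≤ k by omega)
  have hd : (0 : ℝ) < Nat.fib d := by exact_mod_cast Nat.fib_pos.2 (by omega)
  have hsq : ((-1 : ℝ) ^ (j + 1)) * (-1) ^ (j + 1) = 1 := by
    rw [← mul_pow]; simp
  have key : (-1) ^ (j + 1) * ((Nat.fib j : ℝ) * m - Nat.fib (j + 1)) * Nat.fib (j + d) =
      Nat.fib d := by
    linear_combination (-1) ^ (j + 1) * (Nat.fib j : ℝ) * hmul +
      (-1) ^ (j + 1) * Nat.cast_fib_mul_fib_sub_fib_mul_fib (R := ℝ) j d + Nat.fib d * hsq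
  exact pos_of_mul_pos_left (key ▸ hd) hpos.le
end

section
/- Let n ≥ 1 be an integer, let F_k denote the k-th Fibonacci number, and set m = F_{2n+1}/F_{2n} (as a real number). Then m²·F_{2n}·F_{2n+1} - 2m·(F_{2n+1}² - 1) + F_{2n+1}·F_{2n+2} = F_{2n+1}/F_{2n}. (Hence the total area of the quarter-circle sectors after 2n+1 subdivision steps of a rectangle with side ratio F_{2n+1}/F_{2n} is A_{2n+1} = (π/4)·F_{2n+1}/F_{2n}, which tends to πφ/4 as n → ∞.) -/
/-- Cassini's identity at odd indices. -/
theorem fib_two_mul_mul_fib_two_mul_add_two (n : ℕ) :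
    Nat.fib (2 * n) * Nat.fib (2 * n + 2) + 1 = Nat.fib (2 * n + 1) ^ 2 := by
  induction n with
  | zero => simp
  | succ k ih =>
    have h₂ := Nat.fib_add_two (n := 2 * k)
    have h₃ := Nat.fib_add_two (n := 2 * k + 1)
    have h₄ := Nat.fib_add_two (n := 2 * k + 2)
    simp only [mul_add, mul_one, add_assoc, Nat.reduceAdd] at *
    rw [h₂] at ih
    rw [h₄, h₃, h₂]
    linarith

theorem sector_area_odd_case (n : ℕ) (hn : 1 ≤ n) (m : ℝ)
    (hm : m = (Nat.fib (2 * n + 1) : ℝ) / Nat.fib (2 * n)) :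
    m ^ 2 * Nat.fib (2 * n) * Nat.fib (2 * n + 1)
      - 2 * m * ((Nat.fib (2 * n + 1) : ℝ) ^ 2 - 1)
      + Nat.fib (2 * n + 1) * Nat.fib (2 * n + 2)
      = (Nat.fib (2 * n + 1) : ℝ) / Nat.fib (2 * n) := by
  have hpos : (Nat.fib (2 * n) : ℝ) ≠ 0 := by
    exact_mod_cast (Nat.fib_pos.2 (by omega)).ne'
  have hcassini : (Nat.fib (2 * n) : ℝ) * Nat.fib (2 * n + 2) + 1 = Nat.fib (2 * n + 1) ^ 2 := by
    exact_mod_cast fib_two_mul_mul_fib_two_mul_add_two n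
  subst hm
  field_simp
  linear_combination hcassini
end
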